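/- arXiv:2010.06953 — 2 statements merged into one kernel-verified Lean document; each statement's English description precedes it below -/
import Mathlib

section
/- An identity u ≈ v over an alphabet of variables X is satisfied by the hypoplactic monoid hypo if and only if it is satisfied by the additive monoid of natural numbers (equivalently, it is balanced) and it is satisfied by the monoid C_3. (Equivalently, the variety generated by hypo is the varietal join of the variety of commutative monoids and the variety generated by C_3, and is generated by the free monogenic monoid together with C_3.) -/
open FreeMonoid

/-- The alphabet `A = {1 < 2 < 3 < ...}` of positive integers. -/
abbrev Alph : Type := ℕ+

/-- The finite alphabet `A_n = {1 < ... < n}`. -/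
abbrev AlphN (n : ℕ) : Type := {a : ℕ+ // (a : ℕ) ≤ n}

/-- The defining relations of the hypoplactic monoid. -/
def HypoRel (u v : FreeMonoid Alph) : Prop :=
  (∃ a b c : Alph, a ≤ b ∧ b < c ∧
      u = of a * of c * of b ∧ v = of c * of a * of b) ∨
  (∃ a b c : Alph, a < b ∧ b ≤ c ∧
      u = of b * of a * of c ∧ v = of b * of c * of a) ∨
  (∃ a b c d : Alph, a ≤ b ∧ b < c ∧ c ≤ d ∧
      u = of c * of a * of d * of b ∧ v = of a * of c * of b * of d) ∨
  (∃ a b c d : Alph, a < b ∧ b ≤ c ∧ c < d ∧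
      u = of b * of d * of a * of c ∧ v = of d * of b * of c * of a)

/-- The hypoplactic congruence on `A*`: the congruence generated by `HypoRel`. -/
def hypoCon : Con (FreeMonoid Alph) := conGen HypoRel

/-- The infinite-rank hypoplactic monoid `hypo`. -/
abbrev Hypo : Type := hypoCon.Quotient

/-- The inclusion of `A_n*` into `A*`. -/
def inclN (n : ℕ) : FreeMonoid (AlphN n) →* FreeMonoid Alph :=
  FreeMonoid.map Subtype.val

/-- The hypoplactic congruence restricted to `A_n*`. -/
def hypoConN (n : ℕ) : Con (FreeMonoid (AlphN n)) :=
  hypoCon.comap (inclN n) (fun x y => map_mul (inclN n) x y)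

/-- The rank-`n` hypoplactic monoid `hypo_n`. -/
abbrev HypoN (n : ℕ) : Type := (hypoConN n).Quotient

/-- The letter `1` of `A_2`. -/
def a1 : AlphN 2 := ⟨1, by norm_num⟩

/-- The letter `2` of `A_2`. -/
def a2 : AlphN 2 := ⟨2, by norm_num⟩

/-- The homomorphism `φ_{ij} : A* → hypo_2`, sending `i ↦ [1]`, `j ↦ [2]`,
`a ↦ [21]` for `i < a < j`, and every other letter to the identity. -/
def phi (i j : Alph) : FreeMonoid Alph →* HypoN 2 :=
  FreeMonoid.lift fun a =>
    if a = i then (hypoConN 2).mk' (of a1)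
    else if a = j then (hypoConN 2).mk' (of a2)
    else if i < a ∧ a < j then (hypoConN 2).mk' (of a2 * of a1)
    else 1

/-- A monoid `M` satisfies the identity `u ≈ v` (over the alphabet of variables `X`)
if every homomorphic evaluation of the two words in `M` gives equal values. -/
def MSatisfies (M : Type*) [Monoid M] {X : Type*} (u v : FreeMonoid X) : Prop :=
  ∀ ψ : FreeMonoid X →* M, ψ u = ψ v

/-- An identity `u ≈ v` is balanced if every variable occurs the same number of
times in `u` as in `v`. -/
def IsBalanced {X : Type*} [DecidableEq X] (u v : FreeMonoid X) : Prop :=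
  ∀ x : X, u.toList.count x = v.toList.count x

/-- `C3`: the 5-element monoid of all order-preserving and extensive maps of the
chain `1 < 2 < 3` to itself, under composition. -/
def C3 : Type := {f : Fin 3 → Fin 3 // Monotone f ∧ ∀ i, i ≤ f i}

instance : Monoid C3 where
  mul f g := ⟨f.1 ∘ g.1, f.2.1.comp g.2.1, fun i => (g.2.2 i).trans (f.2.2 (g.1 i))⟩
  one := ⟨id, monotone_id, fun _ => le_rfl⟩
  mul_assoc f g h := rfl
  one_mul f := rfl
  mul_one f := rfl

section PivotCommutation

/-- A map from a linear order to a monoid whose values satisfy the hypoplactic relations. -/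
structure IsHypoMap {α M : Type*} [LinearOrder α] [Monoid M] (f : α → M) : Prop where
  acb : ∀ {a b c}, a ≤ b → b < c → f a * f c * f b = f c * f a * f b
  bac : ∀ {a b c}, a < b → b ≤ c → f b * f a * f c = f b * f c * f a
  cadb : ∀ {a b c d}, a ≤ b → b < c → c ≤ d → f c * f a * f d * f b = f a * f c * f b * f d
  bdac : ∀ {a b c d}, a < b → b ≤ c → c < d → f b * f d * f a * f c = f d * f b * f c * f a

/-- Letters `a < c` commute to the right of any `b` with `a < b ≤ c`, at distance at most `n`. -/
def LeftPivot {α M : Type*} [LinearOrder α] [Monoid M] (f : α → M) (n : ℕ) : Prop :=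
  ∀ (a b c : α) (x : List α), x.length ≤ n → a < b → b ≤ c →
    f b * (x.map f).prod * (f c * f a) = f b * (x.map f).prod * (f a * f c)

/-- Letters `a < c` commute to the left of any `b` with `a ≤ b < c`, at distance at most `n`. -/
def RightPivot {α M : Type*} [LinearOrder α] [Monoid M] (f : α → M) (n : ℕ) : Prop :=
  ∀ (a b c : α) (x : List α), x.length ≤ n → a ≤ b → b < c →
    f a * f c * ((x.map f).prod * f b) = f c * f a * ((x.map f).prod * f b)

theorem List.exists_last_of_exists_mem {α : Type*} {p : α → Prop} {l : List α}
    (h : ∃ a ∈ l, p a) : ∃ y a z, l = y ++ a :: z ∧ p a ∧ ∀ b ∈ z, ¬ p b := by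
  induction l with
  | nil => simp at h
  | cons e l ih =>
    by_cases h' : ∃ a ∈ l, p a
    · obtain ⟨y, a, z, rfl, ha, hz⟩ := ih h'
      exact ⟨e :: y, a, z, rfl, ha, hz⟩
    · push Not at h'
      obtain ⟨a, ha, hp⟩ := h
      rcases List.mem_cons.1 ha with rfl | ha
      · exact ⟨[], a, l, rfl, hp, h'⟩
      · exact absurd hp (h' a ha)

variable {α M : Type*} [LinearOrder α] [Monoid M] {f : α → M}

theorem IsHypoMap.dual (hf : IsHypoMap f) :
    IsHypoMap (fun a : αᵒᵈ => MulOpposite.op (f (OrderDual.ofDual a))) where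
  acb {a b c} h1 h2 := by
    have := hf.bac (OrderDual.ofDual_lt_ofDual.2 h2) (OrderDual.ofDual_le_ofDual.2 h1)
    simp only [← MulOpposite.op_mul, ← mul_assoc, this]
  bac {a b c} h1 h2 := by
    have := hf.acb (OrderDual.ofDual_le_ofDual.2 h2) (OrderDual.ofDual_lt_ofDual.2 h1)
    simp only [← MulOpposite.op_mul, ← mul_assoc, this]
  cadb {a b c d} h1 h2 h3 := by
    have := hf.cadb (OrderDual.ofDual_le_ofDual.2 h3) (OrderDual.ofDual_lt_ofDual.2 h2)
      (OrderDual.ofDual_le_ofDual.2 h1)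
    simp only [← MulOpposite.op_mul, ← mul_assoc, this]
  bdac {a b c d} h1 h2 h3 := by
    have := hf.bdac (OrderDual.ofDual_lt_ofDual.2 h3) (OrderDual.ofDual_le_ofDual.2 h2)
      (OrderDual.ofDual_lt_ofDual.2 h1)
    simp only [← MulOpposite.op_mul, ← mul_assoc, this]

theorem RightPivot.of_dual {n : ℕ}
    (h : LeftPivot (fun a : αᵒᵈ => MulOpposite.op (f (OrderDual.ofDual a))) n) :
    RightPivot f n := by
  intro a b c x hx hab hbc
  have key : ∀ x : List α, ((x.reverse.map OrderDual.toDual).map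
      (fun a : αᵒᵈ => MulOpposite.op (f (OrderDual.ofDual a)))).prod
        = MulOpposite.op (x.map f).prod := by
    intro x
    induction x with
    | nil => simp
    | cons e x ih => simp_all
  have := h (OrderDual.toDual c) (OrderDual.toDual b) (OrderDual.toDual a)
    (x.reverse.map OrderDual.toDual) (by simpa using hx) hbc hab
  rw [key] at this
  have := congrArg MulOpposite.unop this
  simpa [mul_assoc] using this.symm

/-- To the right of `e`, a letter `≥ e` moves rightwards past letters `< e`. -/
theorem LeftPivot.move_ge {n : ℕ} (hL : LeftPivot f n) {e g : α} (hg : e ≤ g) (z : List α) :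
    ∀ y : List α, y.length + z.length ≤ n + 1 → (∀ s ∈ z, s < e) →
      f e * (y.map f).prod * (f g * (z.map f).prod)
        = f e * (y.map f).prod * ((z.map f).prod * f g) := by
  induction z with
  | nil => simp
  | cons s z ih =>
    intro y hy hz
    have h1 := hL s e g y (by simp at hy; omega) (hz s (by simp)) hg
    have h2 := ih (y ++ [s]) (by simp at hy ⊢; omega) (fun t ht => hz t (by simp [ht]))
    simp only [List.map_append, List.prod_append, List.map_cons, List.map_nil, List.prod_cons,
      List.prod_nil, mul_one, ← mul_assoc] at h1 h2 ⊢
    rw [h1, h2]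

/-- To the right of `e`, a letter `< e` moves rightwards past letters `≥ e`. -/
theorem LeftPivot.move_lt {n : ℕ} (hL : LeftPivot f n) {e s : α} (hs : s < e) (z : List α) :
    ∀ y : List α, y.length + z.length ≤ n + 1 → (∀ g ∈ z, e ≤ g) →
      f e * (y.map f).prod * (f s * (z.map f).prod)
        = f e * (y.map f).prod * ((z.map f).prod * f s) := by
  induction z with
  | nil => simp
  | cons g z ih =>
    intro y hy hz
    have h1 := hL s e g y (by simp at hy; omega) hs (hz g (by simp))
    have h2 := ih (y ++ [g]) (by simp at hy ⊢; omega) (fun t ht => hz t (by simp [ht]))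
    simp only [List.map_append, List.prod_append, List.map_cons, List.map_nil, List.prod_cons,
      List.prod_nil, mul_one, ← mul_assoc] at h1 h2 ⊢
    rw [← h1, h2]

/-- Removing the first intermediate letter when another one lies on the same side of `(a, c]`. -/
theorem pivot_step {n : ℕ} (hL : LeftPivot f n) (hR : RightPivot f n)
    {a b c e : α} {x : List α} (hx : x.length ≤ n) (hab : a < b) (hbc : b ≤ c)
    (h : ∃ g ∈ x, (c < e ∧ c < g) ∨ (e ≤ a ∧ g ≤ a)) :
    f b * ((e :: x).map f).prod * (f c * f a) = f b * ((e :: x).map f).prod * (f a * f c) := by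
  have hLx := hL a b c x hx hab hbc
  have pull : f b * f e * (x.map f).prod = f e * f b * (x.map f).prod →
      f b * ((e :: x).map f).prod * (f c * f a)
        = f b * ((e :: x).map f).prod * (f a * f c) := by
    intro hp
    simp only [List.map_cons, List.prod_cons, ← mul_assoc] at hLx ⊢
    rw [hp]
    simp only [mul_assoc] at hLx ⊢
    rw [hLx]
  -- a letter `g` of `x` that can be moved to the far right is irrelevant
  have drop : ∀ (y z : List α) (g : α), x = y ++ g :: z →
      (∀ p q : α, (p = a ∧ q = c) ∨ (p = c ∧ q = a) →
        f e * (y.map f).prod * (f g * ((z ++ [p, q]).map f).prod)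
          = f e * (y.map f).prod * (((z ++ [p, q]).map f).prod * f g)) →
      f b * ((e :: x).map f).prod * (f c * f a)
        = f b * ((e :: x).map f).prod * (f a * f c) := by
    rintro y z g rfl hp
    have h1 := hp a c (by simp)
    have h2 := hp c a (by simp)
    have h3 := hL a b c (e :: (y ++ z)) (by simp at hx ⊢; omega) hab hbc
    simp only [List.map_append, List.prod_append, List.map_cons, List.map_nil, List.prod_cons,
      List.prod_nil, mul_one, mul_assoc] at h1 h2 h3 ⊢
    rw [h1, h2]
    simp only [← mul_assoc] at h3 ⊢
    rw [h3]
  rcases h with ⟨g, hg, ⟨hce, hcg⟩ | ⟨hea, hga⟩⟩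
  · by_cases hi : ∃ k ∈ x, b ≤ k ∧ k < e
    · obtain ⟨k, hk, hbk, hke⟩ := hi
      obtain ⟨y, z, rfl⟩ := List.append_of_mem hk
      have := hR b k e y (by simp at hx; omega) hbk hke
      apply pull
      simp only [List.map_append, List.prod_append, List.map_cons, List.prod_cons,
        ← mul_assoc] at this ⊢
      rw [this]
    · push Not at hi
      obtain ⟨y, k, z, rfl, hk, hz⟩ := List.exists_last_of_exists_mem
        (p := fun k => e ≤ k) ⟨g, hg, hi g hg (hbc.trans hcg.le)⟩
      refine drop y z k rfl fun p q hpq => hL.move_ge hk _ y (by simp at hx ⊢; omega) ?_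
      intro s hs
      rcases List.mem_append.1 hs with hs | hs
      · exact not_le.1 (hz s hs)
      · have hae := hab.trans_le (hbc.trans hce.le)
        rcases hpq with ⟨rfl, rfl⟩ | ⟨rfl, rfl⟩ <;> simp at hs <;>
          rcases hs with rfl | rfl <;> assumption
  · by_cases hi : ∃ k ∈ x, e ≤ k ∧ k < b
    · obtain ⟨k, hk, hek, hkb⟩ := hi
      obtain ⟨y, z, rfl⟩ := List.append_of_mem hk
      have := hR e k b y (by simp at hx; omega) hek hkb
      apply pull
      simp only [List.map_append, List.prod_append, List.map_cons, List.prod_cons,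
        ← mul_assoc] at this ⊢
      rw [this]
    · push Not at hi
      obtain ⟨y, k, z, rfl, hk, hz⟩ := List.exists_last_of_exists_mem
        (p := fun k => k < e) ⟨g, hg, not_le.1 fun h => absurd (hi g hg h)
          (not_le.2 (hga.trans_lt hab))⟩
      refine drop y z k rfl fun p q hpq => hL.move_lt hk _ y (by simp at hx ⊢; omega) ?_
      intro s hs
      rcases List.mem_append.1 hs with hs | hs
      · exact not_lt.1 (hz s hs)
      · have hae := hea.trans (hab.trans_le hbc).le
        rcases hpq with ⟨rfl, rfl⟩ | ⟨rfl, rfl⟩ <;> simp at hs <;>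
          rcases hs with rfl | rfl <;> assumption

theorem IsHypoMap.pivot_one (hf : IsHypoMap f) {a b c e : α} (hab : a < b) (hbc : b ≤ c)
    (he : e ≤ a ∨ c < e) : f b * f e * f c * f a = f b * f e * f a * f c := by
  rcases he with he | he
  · rw [hf.cadb he hab hbc, hf.acb he hab]
  · rw [hf.acb hbc he, hf.bdac hab hbc he]

theorem IsHypoMap.pivot_two (hf : IsHypoMap f) (hR : RightPivot f 1) {a b c s g : α}
    (hab : a < b) (hbc : b ≤ c) (hs : s ≤ a) (hg : c < g) :
    f b * f g * f s * f c * f a = f b * f g * f s * f a * f c := by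
  have hsb := hs.trans_lt hab
  have hbg := hbc.trans_lt hg
  have r1 := hR b c g [s] (by simp) hbc hg
  have r2 := hR s a b [c] (by simp) hs hab
  have r3 := hR b c g [a] (by simp) hbc hg
  have r4 := hR s a b [g] (by simp) hs hab
  simp only [List.map_cons, List.map_nil, List.prod_cons, List.prod_nil, mul_one,
    ← mul_assoc] at r1 r2 r3 r4
  calc f b * f g * f s * f c * f a
      = f g * (f b * f s * f c * f a) := by rw [r1]; simp only [mul_assoc]
    _ = f g * f s * (f b * f c * f a) := by rw [← r2]; simp only [mul_assoc]
    _ = f g * f s * f b * f a * f c := by rw [← hf.bac hab hbc]; simp only [mul_assoc]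
    _ = f s * (f g * f b * f a * f c) := by
      rw [← hf.acb hsb.le hbg]; simp only [mul_assoc]
    _ = f s * f b * f g * f a * f c := by rw [← r3]; simp only [mul_assoc]
    _ = f b * f g * f s * f a * f c := by rw [r4, hf.bac hsb hbg.le]

theorem IsHypoMap.leftPivot_succ (hf : IsHypoMap f) {n : ℕ} (hL : LeftPivot f n)
    (hR : RightPivot f n) : LeftPivot f (n + 1) := by
  intro a b c x hx hab hbc
  by_cases hmid : ∃ e ∈ x, a < e ∧ e ≤ c
  · obtain ⟨e, he, hae, hec⟩ := hmid
    obtain ⟨y, z, rfl⟩ := List.append_of_mem he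
    have := hL a e c z (by simp at hx; omega) hae hec
    simp only [List.map_append, List.prod_append, List.map_cons, List.prod_cons,
      mul_assoc] at this ⊢
    rw [this]
  · replace hmid : ∀ e ∈ x, e ≤ a ∨ c < e := by
      intro e he
      by_contra! h
      exact hmid ⟨e, he, h⟩
    have swap : ∀ {s g : α}, s ≤ a → c < g → f b * f s * f g = f b * f g * f s :=
      fun hs hg => hf.bac (hs.trans_lt hab) (hbc.trans hg.le)
    match x, hx, hmid with
    | [], _, _ => simpa [← mul_assoc] using (hf.bac hab hbc).symm
    | [e], _, hmid => simpa [← mul_assoc] using hf.pivot_one hab hbc (hmid e (by simp))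
    | [d, e], hx, hmid =>
      by_cases hs : (c < d ∧ c < e) ∨ (d ≤ a ∧ e ≤ a)
      · exact pivot_step hL hR (by simpa using hx) hab hbc ⟨e, by simp, hs⟩
      have hR1 : RightPivot f 1 := fun a b c x h => hR a b c x (h.trans (by simpa using hx))
      have hd := hmid d (by simp)
      have he := hmid e (by simp)
      simp only [List.map_cons, List.map_nil, List.prod_cons, List.prod_nil, mul_one, ← mul_assoc]
      rcases hd with hd | hd <;> rcases he with he | he
      · exact absurd (Or.inr ⟨hd, he⟩) hs
      · rw [swap hd he, hf.pivot_two hR1 hab hbc hd he]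
      · exact hf.pivot_two hR1 hab hbc he hd
      · exact absurd (Or.inl ⟨hd, he⟩) hs
    | d :: e :: k :: x, hx, hmid =>
      by_cases hs : ∃ g ∈ e :: k :: x, (c < d ∧ c < g) ∨ (d ≤ a ∧ g ≤ a)
      · exact pivot_step hL hR (by simpa using hx) hab hbc hs
      have hd := hmid d (by simp)
      have he := hmid e (by simp)
      have hk := hmid k (by simp)
      have hse : ¬ ((c < d ∧ c < e) ∨ (d ≤ a ∧ e ≤ a)) := fun h => hs ⟨e, by simp, h⟩
      have hsk : ¬ ((c < d ∧ c < k) ∨ (d ≤ a ∧ k ≤ a)) := fun h => hs ⟨k, by simp, h⟩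
      have hde : f b * f d * f e = f b * f e * f d := by
        rcases hd with hd | hd <;> rcases he with he | he
        · exact absurd (Or.inr ⟨hd, he⟩) hse
        · exact swap hd he
        · exact (swap he hd).symm
        · exact absurd (Or.inl ⟨hd, he⟩) hse
      have hek : (c < e ∧ c < k) ∨ (e ≤ a ∧ k ≤ a) := by
        rcases hd with hd | hd <;> rcases he with he | he <;> rcases hk with hk | hk <;>
          simp_all
      have := pivot_step (e := e) (x := d :: k :: x) hL hR (by simpa using hx) hab hbc
        ⟨k, by simp, hek⟩
      simp only [List.map_cons, List.prod_cons, ← mul_assoc] at this ⊢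
      rw [hde, this]

theorem IsHypoMap.leftPivot : ∀ (n : ℕ) {α M : Type _} [LinearOrder α] [Monoid M] {f : α → M},
    IsHypoMap f → LeftPivot f n
  | 0, _, _, _, _, _, hf => by
    intro a b c x hx hab hbc
    obtain rfl : x = [] := List.length_eq_zero_iff.1 (Nat.le_zero.1 hx)
    simpa [← mul_assoc] using (hf.bac hab hbc).symm
  | n + 1, _, _, _, _, _, hf =>
    hf.leftPivot_succ (leftPivot n hf) (RightPivot.of_dual (leftPivot n hf.dual))

theorem IsHypoMap.rightPivot (n : ℕ) (hf : IsHypoMap f) : RightPivot f n :=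
  RightPivot.of_dual (hf.dual.leftPivot n)

end PivotCommutation

section Inversions

open scoped List

variable {α M : Type*} [LinearOrder α] [Monoid M] {f : α → M}

theorem IsHypoMap.swap_of_mem_left (hf : IsHypoMap f) {a c : α} {t : List α} (hac : a < c)
    (hc : c ∈ t) (z : List α) :
    ((t ++ c :: a :: z).map f).prod = ((t ++ a :: c :: z).map f).prod := by
  obtain ⟨t₁, t₂, rfl⟩ := List.append_of_mem hc
  have h := congrArg (fun m => (t₁.map f).prod * m * (z.map f).prod)
    (hf.leftPivot _ a c c t₂ le_rfl hac le_rfl)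
  simpa [mul_assoc] using h

theorem IsHypoMap.swap_of_mem_right (hf : IsHypoMap f) {a c : α} {z : List α} (hac : a < c)
    (ha : a ∈ z) (t : List α) :
    ((t ++ c :: a :: z).map f).prod = ((t ++ a :: c :: z).map f).prod := by
  obtain ⟨z₁, z₂, rfl⟩ := List.append_of_mem ha
  have h := congrArg (fun m => (t.map f).prod * m * (z₂.map f).prod)
    (hf.rightPivot _ a a c z₁ le_rfl le_rfl hac)
  simpa [mul_assoc] using h.symm

/-- A letter moves to the front of a block `y` if every letter of `y` commutes with it
thanks to an occurrence of the larger one before, or of the smaller one after. -/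
theorem IsHypoMap.move_front (hf : IsHypoMap f) (t : List α) (e : α) (y : List α) :
    ∀ z : List α, (∀ g ∈ y, (g < e ∧ (e ∈ t ∨ g ∈ z)) ∨ (e < g ∧ (g ∈ t ∨ e ∈ z))) →
      ((t ++ (y ++ e :: z)).map f).prod = ((t ++ e :: (y ++ z)).map f).prod := by
  induction y using List.reverseRecOn with
  | nil => simp
  | append_singleton y g ih =>
    intro z hz
    have h1 : ((t ++ y ++ g :: e :: z).map f).prod = ((t ++ y ++ e :: g :: z).map f).prod := by
      rcases hz g (by simp) with ⟨hlt, h | h⟩ | ⟨hlt, h | h⟩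
      · exact (hf.swap_of_mem_left hlt (by simp [h]) _).symm
      · exact (hf.swap_of_mem_right hlt h _).symm
      · exact hf.swap_of_mem_left hlt (by simp [h]) _
      · exact hf.swap_of_mem_right hlt h _
    have h2 := ih (g :: z) fun k hk => by
      have := hz k (by simp [hk])
      simp only [List.mem_cons]
      tauto
    simp only [List.append_assoc, List.cons_append, List.nil_append] at h1 h2 ⊢
    rw [h1, h2]

theorem List.pair_sublist_cons_iff {β : Type*} {x y z : β} {l : List β} :
    [x, y] <+ z :: l ↔ (x = z ∧ y ∈ l) ∨ [x, y] <+ l := by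
  rw [List.sublist_cons_iff]
  constructor
  · rintro (h | ⟨r, hr, h⟩)
    · exact Or.inr h
    · obtain ⟨rfl, rfl⟩ := List.cons.inj hr
      exact Or.inl ⟨rfl, List.singleton_sublist.1 h⟩
  · rintro (⟨rfl, h⟩ | h)
    · exact Or.inr ⟨_, rfl, List.singleton_sublist.2 h⟩
    · exact Or.inl h

theorem List.pair_sublist_append_iff {β : Type*} {x y : β} {l l' : List β} :
    [x, y] <+ l ++ l' ↔ [x, y] <+ l ∨ (x ∈ l ∧ y ∈ l') ∨ [x, y] <+ l' := by
  induction l with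
  | nil => simp
  | cons z l ih =>
    simp only [List.cons_append, List.pair_sublist_cons_iff, ih, List.mem_append, List.mem_cons]
    tauto

theorem List.pair_sublist_flatMap_iff {β γ : Type*} {x y : γ} {σ : β → List γ} {l : List β} :
    [x, y] <+ l.flatMap σ ↔
      (∃ p ∈ l, [x, y] <+ σ p) ∨ ∃ p q, [p, q] <+ l ∧ x ∈ σ p ∧ y ∈ σ q := by
  induction l with
  | nil => simp
  | cons z l ih =>
    simp only [List.flatMap_cons, List.pair_sublist_append_iff, ih, List.pair_sublist_cons_iff,
      List.mem_flatMap, List.mem_cons]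
    grind

/-- Words with the same content and the same inversions have the same value. -/
theorem IsHypoMap.prod_eq_of_perm (hf : IsHypoMap f) (w : List α) :
    ∀ t w' : List α, w.Perm w' →
      (∀ a c, a < c → ([c, a] <+ t ++ w ↔ [c, a] <+ t ++ w')) →
      ((t ++ w).map f).prod = ((t ++ w').map f).prod := by
  induction w with
  | nil => rintro t w' hp -; rw [hp.nil_eq]
  | cons e w ih =>
    intro t w' hp hinv
    obtain ⟨y, z, rfl, hey⟩ := List.eq_append_cons_of_mem (hp.mem_iff.1 (List.mem_cons_self))
    replace hp : w.Perm (y ++ z) := (hp.trans List.perm_middle).cons_inv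
    have hmem : ∀ k, k ∈ w ↔ k ∈ y ∨ k ∈ z := fun k => by rw [hp.mem_iff, List.mem_append]
    have hsub : ∀ {p q : α} {l : List α}, [p, q] <+ l → p ∈ l ∧ q ∈ l := fun h =>
      ⟨h.subset (by simp), h.subset (by simp)⟩
    simp only [List.pair_sublist_append_iff, List.pair_sublist_cons_iff, List.mem_append,
      List.mem_cons] at hinv
    have hy : ∀ g ∈ y, (g < e ∧ (e ∈ t ∨ g ∈ z)) ∨ (e < g ∧ (g ∈ t ∨ e ∈ z)) := by
      intro g hg
      rcases lt_or_gt_of_ne (fun h => hey (h ▸ hg) : g ≠ e) with h | h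
      · have := hinv g e h
        grind
      · have := hinv e g h
        grind
    rw [hf.move_front t e y z hy]
    have := ih (t ++ [e]) (y ++ z) hp fun a c hac => by
      have := hinv a c hac
      simp only [List.append_assoc, List.cons_append, List.nil_append,
        List.pair_sublist_append_iff, List.pair_sublist_cons_iff, List.mem_append,
        List.mem_cons]
      grind
    simpa using this

end Inversions

section Evaluation

open scoped List

theorem isHypoMap_mk : IsHypoMap (fun a : Alph => hypoCon.mk' (of a)) where
  acb {a b c} h1 h2 := by
    simp only [← map_mul]
    exact (Con.eq _).2 (ConGen.Rel.of _ _ (Or.inl ⟨a, b, c, h1, h2, rfl, rfl⟩))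
  bac {a b c} h1 h2 := by
    simp only [← map_mul]
    exact (Con.eq _).2 (ConGen.Rel.of _ _ (Or.inr (Or.inl ⟨a, b, c, h1, h2, rfl, rfl⟩)))
  cadb {a b c d} h1 h2 h3 := by
    simp only [← map_mul]
    exact (Con.eq _).2 (ConGen.Rel.of _ _
      (Or.inr (Or.inr (Or.inl ⟨a, b, c, d, h1, h2, h3, rfl, rfl⟩))))
  bdac {a b c d} h1 h2 h3 := by
    simp only [← map_mul]
    exact (Con.eq _).2 (ConGen.Rel.of _ _
      (Or.inr (Or.inr (Or.inr ⟨a, b, c, d, h1, h2, h3, rfl, rfl⟩))))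

/-- Every map satisfying the hypoplactic relations extends to `Hypo`. -/
def IsHypoMap.lift {M : Type*} [Monoid M] {f : Alph → M} (hf : IsHypoMap f) : Hypo →* M :=
  hypoCon.lift (FreeMonoid.lift f) <| Con.conGen_le.2 <| by
    rintro _ _ (⟨a, b, c, h1, h2, rfl, rfl⟩ | ⟨a, b, c, h1, h2, rfl, rfl⟩ |
      ⟨a, b, c, d, h1, h2, h3, rfl, rfl⟩ | ⟨a, b, c, d, h1, h2, h3, rfl, rfl⟩)
    · simpa [Con.ker_rel] using hf.acb h1 h2
    · simpa [Con.ker_rel] using hf.bac h1 h2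
    · simpa [Con.ker_rel] using hf.cadb h1 h2 h3
    · simpa [Con.ker_rel] using hf.bdac h1 h2 h3

theorem IsHypoMap.lift_mk {M : Type*} [Monoid M] {f : Alph → M} (hf : IsHypoMap f) (a : Alph) :
    hf.lift (hypoCon.mk' (of a)) = f a :=
  (Con.lift_mk' _ _).trans (FreeMonoid.lift_eval_of f a)

theorem MSatisfies.of_surjective {M N X : Type*} [Monoid M] [Monoid N] {u v : FreeMonoid X}
    (h : MSatisfies M u v) (π : M →* N) (hπ : Function.Surjective π) : MSatisfies N u v := by
  intro ψ
  choose s hs using hπ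
  have : π.comp (FreeMonoid.lift fun x => s (ψ (of x))) = ψ :=
    FreeMonoid.hom_eq fun x => by simp [hs]
  rw [← this, MonoidHom.comp_apply, MonoidHom.comp_apply, h]

theorem FreeMonoid.map_eq_prod {X M : Type*} [Monoid M] (ψ : FreeMonoid X →* M)
    (u : FreeMonoid X) : ψ u = (u.toList.map fun x => ψ (of x)).prod := by
  conv_lhs => rw [← FreeMonoid.lift_restrict ψ]
  rw [FreeMonoid.lift_apply]
  rfl

theorem toList_perm_of_mSatisfies_nat {X : Type*} {u v : FreeMonoid X}
    (h : MSatisfies (Multiplicative ℕ) u v) : u.toList.Perm v.toList := by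
  classical
  have key : ∀ (x : X) (l : List X),
      (l.map fun y => if y = x then Multiplicative.ofAdd 1 else 1).prod
        = Multiplicative.ofAdd (l.count x) := by
    intro x l
    induction l with
    | nil => rfl
    | cons y l ih =>
      rw [List.map_cons, List.prod_cons, ih]
      by_cases hy : y = x
      · simp [hy, ← ofAdd_add, add_comm]
      · simp [hy]
  refine List.perm_iff_count.2 fun x => ?_
  have := h (FreeMonoid.lift fun y => if y = x then Multiplicative.ofAdd 1 else 1)
  rw [FreeMonoid.lift_apply, FreeMonoid.lift_apply, key, key] at this
  exact this

/-- The element of `C3` fixing all points but `0 ↦ 1`. -/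
def C3.lower : C3 := ⟨![1, 1, 2], by decide, by decide⟩

/-- The element of `C3` fixing all points but `1 ↦ 2`. -/
def C3.upper : C3 := ⟨![0, 2, 2], by decide, by decide⟩

open scoped Classical in
theorem C3.prod_apply_zero {X : Type*} {x y : X} (hxy : x ≠ y) (l : List X) :
    (l.map fun z => if z = x then C3.upper else if z = y then C3.lower else 1).prod.1 0
      = if [x, y] <+ l then 2 else if y ∈ l then 1 else 0 := by
  have hmul : ∀ p q : C3, (p * q).1 0 = p.1 (q.1 0) := fun _ _ => rfl
  have hone : ∀ i, (1 : C3).1 i = i := fun _ => rfl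
  induction l with
  | nil => simp [hone]
  | cons z l ih =>
    rw [List.map_cons, List.prod_cons, hmul, ih]
    have hsub : [x, y] <+ l → y ∈ l := fun h => h.subset (by simp)
    simp only [List.pair_sublist_cons_iff, List.mem_cons]
    by_cases h1 : z = x
    · subst h1
      by_cases h2 : [z, y] <+ l <;> by_cases h3 : y ∈ l <;>
        simp_all [C3.upper, hxy.symm]
    · by_cases h4 : z = y
      · subst h4
        by_cases h2 : [x, z] <+ l <;> by_cases h3 : z ∈ l <;> simp_all [C3.lower]
      · have h1' : x ≠ z := fun h => h1 h.symm
        have h4' : y ≠ z := fun h => h4 h.symm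
        simp [h1, h4, h1', h4', hone]

theorem pair_sublist_iff_of_mSatisfies_C3 {X : Type*} {u v : FreeMonoid X}
    (h : MSatisfies C3 u v) {x y : X} (hxy : x ≠ y) :
    [x, y] <+ u.toList ↔ [x, y] <+ v.toList := by
  classical
  have := congrArg (fun p : C3 => p.1 0)
    (h (FreeMonoid.lift fun z => if z = x then C3.upper else if z = y then C3.lower else 1))
  simp only [FreeMonoid.lift_apply] at this
  have hu := C3.prod_apply_zero hxy u.toList
  have hv := C3.prod_apply_zero hxy v.toList
  split_ifs at hu hv <;> simp_all

theorem isHypoMap_length : IsHypoMap fun _ : Alph => Multiplicative.ofAdd 1 := by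
  constructor <;> intros <;> rfl

theorem isHypoMap_C3 :
    IsHypoMap fun a : Alph => if a = 1 then C3.lower else if a = 2 then C3.upper else 1 := by
  have hLL : C3.lower * C3.lower = C3.lower := Subtype.ext (by decide)
  have hUU : C3.upper * C3.upper = C3.upper := Subtype.ext (by decide)
  have hULL : C3.upper * C3.lower * C3.lower = C3.upper * C3.lower := Subtype.ext (by decide)
  have hLUL : C3.lower * C3.upper * C3.lower = C3.upper * C3.lower := Subtype.ext (by decide)
  have hULU : C3.upper * C3.lower * C3.upper = C3.upper * C3.lower := Subtype.ext (by decide)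
  constructor
  all_goals
    intro a b c
    intros
    have ha := a.pos
    have hb := b.pos
    simp only [← PNat.coe_le_coe, ← PNat.coe_lt_coe] at *
    simp only [← PNat.coe_inj, PNat.val_ofNat]
    split_ifs <;> first
      | omega
      | simp only [one_mul, mul_one, hLL, hUU, hULL, hLUL, hULU]

theorem C3.exists_prod_eq (p : C3) :
    ∃ l : List Alph, p = (l.map fun a : Alph =>
      if a = 1 then C3.lower else if a = 2 then C3.upper else 1).prod := by
  have h2 : p.1 2 = 2 := le_antisymm (Fin.le_last _) (p.2.2 2)
  have h01 : p.1 0 ≤ p.1 1 := p.2.1 (by decide)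
  have h1 : 1 ≤ p.1 1 := p.2.2 1
  have ext : ∀ q : C3, p.1 0 = q.1 0 → p.1 1 = q.1 1 → q.1 2 = 2 → p = q := fun q e0 e1 e2 =>
    Subtype.ext <| funext fun i => by
      fin_cases i
      exacts [e0, e1, h2.trans e2.symm]
  have : (p.1 0 = 0 ∧ p.1 1 = 1) ∨ (p.1 0 = 1 ∧ p.1 1 = 1) ∨ (p.1 0 = 0 ∧ p.1 1 = 2) ∨
      (p.1 0 = 1 ∧ p.1 1 = 2) ∨ (p.1 0 = 2 ∧ p.1 1 = 2) := by
    omega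
  rcases this with ⟨e0, e1⟩ | ⟨e0, e1⟩ | ⟨e0, e1⟩ | ⟨e0, e1⟩ | ⟨e0, e1⟩
  · exact ⟨[], ext _ e0 e1 rfl⟩
  · exact ⟨[1], ext _ e0 e1 rfl⟩
  · exact ⟨[2], ext _ e0 e1 rfl⟩
  · exact ⟨[1, 2], ext _ e0 e1 rfl⟩
  · exact ⟨[2, 1], ext _ e0 e1 rfl⟩

theorem IsHypoMap.lift_surjective {M : Type*} [Monoid M] {f : Alph → M} (hf : IsHypoMap f)
    (h : ∀ p, ∃ l : List Alph, p = (l.map f).prod) : Function.Surjective hf.lift := by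
  intro p
  obtain ⟨l, rfl⟩ := h p
  refine ⟨(l.map fun a => hypoCon.mk' (of a)).prod, ?_⟩
  rw [map_list_prod, List.map_map]
  exact congrArg List.prod (List.map_congr_left fun a _ => hf.lift_mk a)

/-- The value of a word in `Hypo` depends only on its content and its subwords of length two. -/
theorem mSatisfies_hypo_of_perm {X : Type*} {u v : FreeMonoid X}
    (hp : u.toList.Perm v.toList)
    (hs : ∀ x y, [x, y] <+ u.toList ↔ [x, y] <+ v.toList) : MSatisfies Hypo u v := by
  intro ψ
  have hσ : ∀ x, ∃ l : List Alph, ψ (of x) = (l.map fun a => hypoCon.mk' (of a)).prod := by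
    intro x
    obtain ⟨w, hw⟩ := hypoCon.mk'_surjective (ψ (of x))
    exact ⟨w.toList, by rw [← hw, FreeMonoid.map_eq_prod]⟩
  choose σ hσ using hσ
  have key : ∀ w : FreeMonoid X,
      ψ w = ((w.toList.flatMap σ).map fun a => hypoCon.mk' (of a)).prod := by
    intro w
    rw [FreeMonoid.map_eq_prod]
    induction w.toList with
    | nil => rfl
    | cons x l ih =>
      rw [List.map_cons, List.prod_cons, ih, List.flatMap_cons, List.map_append,
        List.prod_append, hσ]
  rw [key, key]
  refine isHypoMap_mk.prod_eq_of_perm _ [] _ (hp.flatMap_right σ) fun a c _ => ?_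
  have h := List.pair_sublist_flatMap_iff (x := c) (y := a) (σ := σ) (l := u.toList)
  simp only [hs, hp.mem_iff] at h
  exact h.trans List.pair_sublist_flatMap_iff.symm

end Evaluation

/-- An identity `u ≈ v` is satisfied by `hypo` if and only if it is satisfied by the
additive monoid of natural numbers (equivalently, it is balanced) and by the monoid
`C3`; that is, the variety generated by `hypo` is the varietal join of the variety of
commutative monoids and the variety generated by `C3`, and is generated by the free
monogenic monoid together with `C3`. -/
theorem hypo_variety_join {X : Type*} (u v : FreeMonoid X) :
    MSatisfies Hypo u v ↔
      (MSatisfies (Multiplicative ℕ) u v ∧ MSatisfies C3 u v) := by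
  constructor
  · intro h
    refine ⟨h.of_surjective isHypoMap_length.lift (isHypoMap_length.lift_surjective fun p =>
      ⟨List.replicate p.toAdd 1, ?_⟩),
      h.of_surjective isHypoMap_C3.lift (isHypoMap_C3.lift_surjective C3.exists_prod_eq)⟩
    rw [List.map_replicate, List.prod_replicate, ← ofAdd_nsmul, smul_eq_mul, mul_one,
      ofAdd_toAdd]
  · rintro ⟨hN, hC⟩
    classical
    have hp := toList_perm_of_mSatisfies_nat hN
    refine mSatisfies_hypo_of_perm hp fun x y => ?_
    by_cases hxy : x = y
    · subst hxy
      have := hp.count_eq x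
      rw [show [x, x] = List.replicate 2 x from rfl, List.replicate_sublist_iff,
        List.replicate_sublist_iff, this]
    · exact pair_sublist_iff_of_mSatisfies_C3 hC hxy
end

section
/- For every n ≥ 2: (a) for distinct variables x, a_1, ..., a_{n-1}, the hypoplactic monoid hypo satisfies the nontrivial identity x a_1 ⋯ a_{n-1} x x ≈ x x a_1 ⋯ a_{n-1} x, which involves exactly n variables and has length n + 2; and (b) every nontrivial identity u ≈ v satisfied by hypo in which exactly n distinct variables occur has |u| = |v| ≥ n + 2. Hence the shortest nontrivial identity with n variables satisfied by hypo has length n + 2. -/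
open FreeMonoid

/-- The class of a list of letters in the hypoplactic monoid. -/
def hypoMk (l : List Alph) : Hypo := hypoCon.mk' (ofList l)

theorem hypoMk_append (l l' : List Alph) : hypoMk (l ++ l') = hypoMk l * hypoMk l' := by
  simp [hypoMk]

theorem hypoMk_congr {l l' : List Alph} (h : hypoMk l = hypoMk l') (p s : List Alph) :
    hypoMk (p ++ (l ++ s)) = hypoMk (p ++ (l' ++ s)) := by
  simp only [hypoMk_append, h]

theorem hypoMk_eq_of_rel {l l' : List Alph} (h : HypoRel (ofList l) (ofList l')) :
    hypoMk l = hypoMk l' :=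
  (Con.eq _).2 (ConGen.Rel.of _ _ h)

/-- `ac` may be swapped to the left of a letter `b` with `a ≤ b < c` at distance at most `N`. -/
def RightSwap (N : ℕ) : Prop :=
  ∀ (a b c : Alph) (z : List Alph), z.length ≤ N → a ≤ b → b < c → ∀ p s : List Alph,
    hypoMk (p ++ a :: c :: (z ++ b :: s)) = hypoMk (p ++ c :: a :: (z ++ b :: s))

/-- `ac` may be swapped to the right of a letter `b` with `a < b ≤ c` at distance at most `N`. -/
def LeftSwap (N : ℕ) : Prop :=
  ∀ (a b c : Alph) (z : List Alph), z.length ≤ N → a < b → b ≤ c → ∀ p s : List Alph,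
    hypoMk (p ++ b :: (z ++ a :: c :: s)) = hypoMk (p ++ b :: (z ++ c :: a :: s))

theorem rightSwap_zero : RightSwap 0 := by
  intro a b c z hz hab hbc p s
  obtain rfl : z = [] := by simpa using hz
  have h : hypoMk [a, c, b] = hypoMk [c, a, b] :=
    hypoMk_eq_of_rel (Or.inl ⟨a, b, c, hab, hbc, rfl, rfl⟩)
  simpa using hypoMk_congr h p s

theorem leftSwap_zero : LeftSwap 0 := by
  intro a b c z hz hab hbc p s
  obtain rfl : z = [] := by simpa using hz
  have h : hypoMk [b, a, c] = hypoMk [b, c, a] :=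
    hypoMk_eq_of_rel (Or.inr (Or.inl ⟨a, b, c, hab, hbc, rfl, rfl⟩))
  simpa using hypoMk_congr h p s

/-- A letter satisfying `Q` can be moved to the front of `z`, if swaps of letters in and out of `Q`
are permitted by the letter `b` to the right of `z`. -/
theorem RightSwap.exists_move_front {N : ℕ} (hR : RightSwap N) {Q : Alph → Prop} {b : Alph}
    {z : List Alph} (hN : z.length ≤ N) (hz : ∃ y ∈ z, Q y)
    (hQ : ∀ h ∈ z, ¬ Q h → ∀ y, Q y → (h ≤ b ∧ b < y) ∨ (y ≤ b ∧ b < h)) :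
    ∃ y z', Q y ∧ z'.length + 1 = z.length ∧ ∀ (e : Alph) (p s : List Alph),
      hypoMk (p ++ (z ++ e :: b :: s)) = hypoMk (p ++ y :: (z' ++ e :: b :: s)) ∧
      hypoMk (p ++ (z ++ b :: s)) = hypoMk (p ++ y :: (z' ++ b :: s)) := by
  induction z with
  | nil => simp at hz
  | cons h t ih =>
    by_cases hh : Q h
    · exact ⟨h, t, hh, by simp, fun e p s => ⟨rfl, rfl⟩⟩
    · have ht : ∃ y ∈ t, Q y := by
        obtain ⟨y, hy, hQy⟩ := hz
        rcases List.mem_cons.1 hy with rfl | hy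
        · exact absurd hQy hh
        · exact ⟨y, hy, hQy⟩
      simp only [List.length_cons] at hN
      obtain ⟨y, z', hQy, hlen, hm⟩ := ih (by omega) ht fun k hk => hQ k (List.mem_cons_of_mem _ hk)
      have swap : ∀ (x p s : List Alph), x.length ≤ N →
          hypoMk (p ++ h :: y :: (x ++ b :: s)) = hypoMk (p ++ y :: h :: (x ++ b :: s)) := by
        intro x p s hx
        rcases hQ h (by simp) hh y hQy with ⟨h1, h2⟩ | ⟨h1, h2⟩
        · exact hR h b y x hx h1 h2 p s
        · exact (hR y b h x hx h1 h2 p s).symm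
      refine ⟨y, h :: z', hQy, by simpa using hlen, fun e p s => ⟨?_, ?_⟩⟩
      · have h1 := (hm e (p ++ [h]) s).1
        have h2 := swap (z' ++ [e]) p s (by simp; omega)
        simp only [List.append_assoc, List.cons_append, List.nil_append] at h1 h2 ⊢
        exact h1.trans h2
      · have h1 := (hm e (p ++ [h]) s).2
        have h2 := swap z' p s (by omega)
        simp only [List.append_assoc, List.cons_append, List.nil_append] at h1 h2 ⊢
        exact h1.trans h2

/-- The relation `cadb = acbd` with a word `z` inserted in the middle. -/
theorem hypoMk_double_swap_inner {N : ℕ} (hR : RightSwap N) (hL : LeftSwap N) {a b c d : Alph}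
    (hab : a ≤ b) (hbc : b < c) (hcd : c ≤ d) (z : List Alph) (hz : z.length ≤ N)
    (p s : List Alph) :
    hypoMk (p ++ c :: a :: (z ++ d :: b :: s)) = hypoMk (p ++ a :: c :: (z ++ b :: d :: s)) := by
  induction hk : z.length generalizing z s p with
  | zero =>
    obtain rfl : z = [] := by simpa using hk
    have h : hypoMk [c, a, d, b] = hypoMk [a, c, b, d] :=
      hypoMk_eq_of_rel (Or.inr (Or.inr (Or.inl ⟨a, b, c, d, hab, hbc, hcd, rfl, rfl⟩)))
    simpa using hypoMk_congr h p s
  | succ k ih =>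
    by_cases h1 : ∃ y ∈ z, a ≤ y ∧ y < c
    · obtain ⟨y, hy, hay, hyc⟩ := h1
      obtain ⟨z1, z2, rfl⟩ := List.append_of_mem hy
      simp only [List.length_append, List.length_cons] at hz
      have e1 := hR a y c z1 (by omega) hay hyc p (z2 ++ d :: b :: s)
      have e2 := hL b c d (z1 ++ y :: z2) (by simp; omega) hbc hcd (p ++ [a]) s
      simp only [List.append_assoc, List.cons_append, List.nil_append] at e1 e2 ⊢
      exact e1.symm.trans e2.symm
    by_cases h2 : ∃ y ∈ z, b < y ∧ y ≤ d
    · obtain ⟨y, hy, hay, hyc⟩ := h2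
      obtain ⟨z1, z2, rfl⟩ := List.append_of_mem hy
      simp only [List.length_append, List.length_cons] at hz
      have e1 := hL b y d z2 (by omega) hay hyc (p ++ c :: a :: z1) s
      have e2 := hR a b c (z1 ++ y :: z2) (by simp; omega) hab hbc p (d :: s)
      simp only [List.append_assoc, List.cons_append] at e1 e2 ⊢
      exact e1.symm.trans e2.symm
    push Not at h1 h2
    by_cases h3 : ∃ y ∈ z, d < y
    · obtain ⟨y, z', hdy, hlen, hm⟩ := hR.exists_move_front (b := b) hz h3 (by
        intro h hh hd y hy
        refine Or.inl ⟨?_, by order⟩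
        by_contra hb
        exact hd (h2 h hh (not_le.1 hb)))
      have e0 := (hm d (p ++ [c, a]) s).1
      have e1 := hL a c y [] (by simp) (by order) (by order) p (z' ++ d :: b :: s)
      have e2 := hR c d y (a :: z') (by simp; omega) hcd hdy p (b :: s)
      have e3 := ih z' (by omega) (p ++ [y]) s (by omega)
      have e4 := hR a c y [] (by simp) (by order) (by order) p (z' ++ b :: d :: s)
      have e5 := hR c d y (z' ++ [b]) (by simp; omega) hcd hdy (p ++ [a]) s
      have e6 := (hm d (p ++ [a, c]) (d :: s)).2
      simp only [List.append_assoc, List.cons_append, List.nil_append] at e0 e1 e2 e3 e4 e5 e6 ⊢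
      rw [e0, e1, e2, e3, ← e4, ← e5, e6]
    · push Not at h3
      obtain ⟨z', y, rfl⟩ : ∃ z' y, z = z' ++ [y] := by
        rcases List.eq_nil_or_concat z with rfl | ⟨z', y, h⟩
        · simp at hk
        · exact ⟨z', y, by simpa using h⟩
      have hya : y < a := by
        by_contra hya
        have := h1 y (by simp) (by order)
        have := h2 y (by simp) (by order)
        have := h3 y (by simp)
        order
      simp only [List.length_append, List.length_cons, List.length_nil] at hz hk
      have e1 := hR y b d [] (by simp) (by order) (by order) (p ++ c :: a :: z') s
      have e2 := hL y a b (z' ++ [d]) (by simp; omega) hya hab (p ++ [c]) s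
      have e3 := ih z' (by omega) p (y :: s) (by omega)
      have e4 := hL y b d [] (by simp) (by order) (by order) (p ++ a :: c :: z') s
      have e5 := hL y a b (c :: z') (by simp; omega) hya hab p (d :: s)
      simp only [List.append_assoc, List.cons_append, List.nil_append] at e1 e2 e3 e4 e5 ⊢
      rw [e1, e2, e3, ← e4, ← e5]

/-- The relation `bdac = dbca` with a word `z` inserted in the middle. -/
theorem hypoMk_double_swap_outer {N : ℕ} (hR : RightSwap N) (hL : LeftSwap N) {a b c d : Alph}
    (hab : a < b) (hbc : b ≤ c) (hcd : c < d) (z : List Alph) (hz : z.length ≤ N)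
    (p s : List Alph) :
    hypoMk (p ++ b :: d :: (z ++ a :: c :: s)) = hypoMk (p ++ d :: b :: (z ++ c :: a :: s)) := by
  induction hk : z.length generalizing z s p with
  | zero =>
    obtain rfl : z = [] := by simpa using hk
    have h : hypoMk [b, d, a, c] = hypoMk [d, b, c, a] :=
      hypoMk_eq_of_rel (Or.inr (Or.inr (Or.inr ⟨a, b, c, d, hab, hbc, hcd, rfl, rfl⟩)))
    simpa using hypoMk_congr h p s
  | succ k ih =>
    by_cases h1 : ∃ y ∈ z, b ≤ y ∧ y < d
    · obtain ⟨y, hy, hay, hyc⟩ := h1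
      obtain ⟨z1, z2, rfl⟩ := List.append_of_mem hy
      simp only [List.length_append, List.length_cons] at hz
      have e1 := hR b y d z1 (by omega) hay hyc p (z2 ++ a :: c :: s)
      have e2 := hL a b c (z1 ++ y :: z2) (by simp; omega) hab hbc (p ++ [d]) s
      simp only [List.append_assoc, List.cons_append, List.nil_append] at e1 e2 ⊢
      exact e1.trans e2
    by_cases h2 : ∃ y ∈ z, a < y ∧ y ≤ c
    · obtain ⟨y, hy, hay, hyc⟩ := h2
      obtain ⟨z1, z2, rfl⟩ := List.append_of_mem hy
      simp only [List.length_append, List.length_cons] at hz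
      have e1 := hL a y c z2 (by omega) hay hyc (p ++ b :: d :: z1) s
      have e2 := hR b c d (z1 ++ y :: z2) (by simp; omega) hbc hcd p (a :: s)
      simp only [List.append_assoc, List.cons_append] at e1 e2 ⊢
      exact e1.trans e2
    push Not at h1 h2
    by_cases h3 : ∃ y ∈ z, y ≤ a
    · obtain ⟨y, z', hya, hlen, hm⟩ := hR.exists_move_front (b := c) hz h3 (by
        intro h hh ha y hy
        exact Or.inr ⟨by order, h2 h hh (not_le.1 ha)⟩)
      have e0 := (hm a (p ++ [b, d]) s).1
      have e1 := hR y a d z' (by omega) hya (by order) (p ++ [b]) (c :: s)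
      have e2 := hR y a b (d :: z') (by simp; omega) hya hab p (c :: s)
      have e3 := ih z' (by omega) (p ++ [y]) s (by omega)
      have e4 := hR y b d [] (by simp) (by order) (by order) p (z' ++ c :: a :: s)
      have e5 := hR y a b (z' ++ [c]) (by simp; omega) hya hab (p ++ [d]) s
      have e6 := (hm a (p ++ [d, b]) (a :: s)).2
      simp only [List.append_assoc, List.cons_append, List.nil_append] at e0 e1 e2 e3 e4 e5 e6 ⊢
      rw [e0, ← e1, ← e2, e3, e4, e5, e6]
    · push Not at h3
      obtain ⟨z', y, rfl⟩ : ∃ z' y, z = z' ++ [y] := by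
        rcases List.eq_nil_or_concat z with rfl | ⟨z', y, h⟩
        · simp at hk
        · exact ⟨z', y, by simpa using h⟩
      have hdy : d ≤ y := by
        have := h3 y (by simp)
        have := h2 y (by simp) (by order)
        exact h1 y (by simp) (by order)
      simp only [List.length_append, List.length_cons, List.length_nil] at hz hk
      have e1 := hL a d y z' (by omega) (by order) hdy (p ++ [b]) (c :: s)
      have e2 := hL c d y (z' ++ [a]) (by simp; omega) hcd hdy (p ++ [b]) s
      have e3 := ih z' (by omega) p (y :: s) (by omega)
      have e4 := hL a c y [] (by simp) (by order) (by order) (p ++ d :: b :: z') s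
      have e5 := hL c d y (b :: z') (by simp; omega) hcd hdy p (a :: s)
      simp only [List.append_assoc, List.cons_append, List.nil_append] at e1 e2 e3 e4 e5 ⊢
      rw [← e1, ← e2, e3, e4, e5]

theorem rightSwap_and_leftSwap (N : ℕ) : RightSwap N ∧ LeftSwap N := by
  induction N with
  | zero => exact ⟨rightSwap_zero, leftSwap_zero⟩
  | succ N ih =>
    obtain ⟨hR, hL⟩ := ih
    refine ⟨?_, ?_⟩
    · intro a b c z hz hab hbc p s
      rcases List.eq_nil_or_concat z with rfl | ⟨z', y, h⟩
      · exact hR a b c [] (by simp) hab hbc p s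
      obtain rfl : z = z' ++ [y] := by simpa using h
      have hz' : z'.length ≤ N := by simpa using hz
      simp only [List.append_assoc, List.cons_append, List.nil_append]
      rcases lt_or_ge y a with hya | hay
      · have e1 := hypoMk_double_swap_outer hR hL hya hab hbc z' hz' p s
        have e2 := hL y a b z' hz' hya hab (p ++ [c]) s
        simp only [List.append_assoc, List.cons_append, List.nil_append] at e1 e2
        rw [e1, e2]
      rcases lt_or_ge y c with hyc | hcy
      · exact hR a y c z' hz' hay hyc p (b :: s)
      · have e1 := hypoMk_double_swap_inner hR hL hab hbc hcy z' hz' p s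
        have e2 := hL b c y z' hz' hbc hcy (p ++ [a]) s
        simp only [List.append_assoc, List.cons_append, List.nil_append] at e1 e2
        rw [e1, e2]
    · intro a b c z hz hab hbc p s
      rcases z with _ | ⟨y, z'⟩
      · exact hL a b c [] (by simp) hab hbc p s
      have hz' : z'.length ≤ N := by simpa using hz
      simp only [List.cons_append]
      rcases le_or_gt y a with hya | hay
      · have e1 := hypoMk_double_swap_inner hR hL hya hab hbc z' hz' p s
        have e2 := hR y a b z' hz' hya hab p (c :: s)
        rw [e1, e2]
      rcases le_or_gt y c with hyc | hcy
      · simpa using hL a y c z' hz' hay hyc (p ++ [b]) s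
      · have e1 := hypoMk_double_swap_outer hR hL hab hbc hcy z' hz' p s
        have e2 := hR b c y z' hz' hbc hcy p (a :: s)
        rw [e1, e2]

/-- A letter `c` that also occurs on both sides commutes with its neighbour. -/
theorem hypoMk_swap_of_mem {c : Alph} (d : Alph) {p t : List Alph} (hp : c ∈ p) (ht : c ∈ t) :
    hypoMk (p ++ d :: c :: t) = hypoMk (p ++ c :: d :: t) := by
  rcases lt_trichotomy d c with h | rfl | h
  · obtain ⟨p1, p2, rfl⟩ := List.append_of_mem hp
    simpa using (rightSwap_and_leftSwap p2.length).2 d c c p2 le_rfl h le_rfl p1 t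
  · rfl
  · obtain ⟨t1, t2, rfl⟩ := List.append_of_mem ht
    exact ((rightSwap_and_leftSwap t1.length).1 c c d t1 le_rfl le_rfl h p t2).symm

theorem hypoMk_move_left_of_mem {c : Alph} (t : List Alph) {p r : List Alph}
    (hp : c ∈ p) (hr : c ∈ r) :
    hypoMk (p ++ (t ++ c :: r)) = hypoMk (p ++ c :: (t ++ r)) := by
  induction t generalizing p with
  | nil => rfl
  | cons d t ih =>
    have e1 := ih (p := p ++ [d]) (by simp [hp])
    have e2 := hypoMk_swap_of_mem d hp (t := t ++ r) (by simp [hr])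
    simp only [List.append_assoc, List.cons_append, List.nil_append] at e1 e2 ⊢
    rw [e1, e2]

theorem hypoMk_move_word_left (t q : List Alph) {p r : List Alph}
    (hp : ∀ c ∈ q, c ∈ p) (hr : ∀ c ∈ q, c ∈ r) :
    hypoMk (p ++ (t ++ (q ++ r))) = hypoMk (p ++ (q ++ (t ++ r))) := by
  induction q generalizing p with
  | nil => rfl
  | cons c q ih =>
    have e1 := hypoMk_move_left_of_mem t (hp c (by simp)) (r := q ++ r)
      (by simp [hr c (by simp)])
    have e2 := ih (p := p ++ [c]) (fun e he => by simp [hp e (by simp [he])])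
      (fun e he => hr e (by simp [he]))
    simp only [List.append_assoc, List.cons_append, List.nil_append] at e1 e2 ⊢
    rw [e1, e2]

theorem hypo_mul_mul_self (s t : Hypo) : s * t * s * s = s * s * t * s := by
  obtain ⟨s', rfl⟩ := Con.mk'_surjective (c := hypoCon) s
  obtain ⟨t', rfl⟩ := Con.mk'_surjective (c := hypoCon) t
  have h := hypoMk_move_word_left t'.toList s'.toList (p := s'.toList) (r := s'.toList)
    (fun _ h => h) (fun _ h => h)
  simpa [hypoMk_append, hypoMk, mul_assoc] using h

theorem pair_sublist_cons {α : Type*} {x y a : α} {l : List α} :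
    [x, y].Sublist (a :: l) ↔ [x, y].Sublist l ∨ (x = a ∧ y ∈ l) := by
  rw [List.sublist_cons_iff]
  refine or_congr_right ⟨?_, ?_⟩
  · rintro ⟨r, h, hr⟩
    obtain ⟨rfl, rfl⟩ := List.cons.inj h
    exact ⟨rfl, List.singleton_sublist.1 hr⟩
  · rintro ⟨rfl, h⟩
    exact ⟨[y], rfl, List.singleton_sublist.2 h⟩

theorem pair_sublist_append {α : Type*} {x y : α} {l l' : List α} :
    [x, y].Sublist (l ++ l') ↔
      [x, y].Sublist l ∨ [x, y].Sublist l' ∨ (x ∈ l ∧ y ∈ l') := by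
  induction l with
  | nil => simp
  | cons a l ih =>
    simp only [List.cons_append, pair_sublist_cons, ih, List.mem_append, List.mem_cons]
    tauto

/-- The congruence on `A*` that records which of the letters `1, 2` occur and whether some `2`
precedes some `1`. -/
def inversionCon : Con (FreeMonoid Alph) where
  r u v := ((1 ∈ u.toList ↔ 1 ∈ v.toList) ∧ (2 ∈ u.toList ↔ 2 ∈ v.toList)) ∧
    ([2, 1].Sublist u.toList ↔ [2, 1].Sublist v.toList)
  iseqv :=
    ⟨fun _ => by simp, fun h => by grind, fun h h' => by grind⟩
  mul' := by
    intro u v w x h h'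
    simp only [toList_mul, List.mem_append, pair_sublist_append]
    grind

theorem hypoCon_le_inversionCon : hypoCon ≤ inversionCon := by
  refine Con.conGen_le.2 fun u v h => ?_
  have h1 : ∀ a : Alph, 1 = a ↔ (a : ℕ) = 1 := fun a => by rw [← PNat.coe_inj, eq_comm]; rfl
  have h2 : ∀ a : Alph, 2 = a ↔ (a : ℕ) = 2 := fun a => by rw [← PNat.coe_inj, eq_comm]; rfl
  have hs : ∀ a : Alph, ¬ [2, 1].Sublist [a] := fun a h => by simpa using h.length_le
  change ((_ ↔ _) ∧ (_ ↔ _)) ∧ (_ ↔ _)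
  rcases h with ⟨a, b, c, hab, hbc, rfl, rfl⟩ | ⟨a, b, c, hab, hbc, rfl, rfl⟩ |
    ⟨a, b, c, d, hab, hbc, hcd, rfl, rfl⟩ | ⟨a, b, c, d, hab, hbc, hcd, rfl, rfl⟩ <;>
  · simp only [toList_mul, toList_of, List.mem_append, pair_sublist_append, List.mem_singleton,
      h1, h2, hs, false_or]
    simp only [← PNat.coe_le_coe, ← PNat.coe_lt_coe] at *
    have := a.pos
    omega

/-- The congruence on `A*` that records the number of occurrences of each letter. -/
def contentCon : Con (FreeMonoid Alph) where
  r u v := u.toList.Perm v.toList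
  iseqv := ⟨fun _ => .refl _, fun h => h.symm, fun h h' => h.trans h'⟩
  mul' := fun h h' => h.append h'

theorem hypoCon_le_contentCon : hypoCon ≤ contentCon := by
  refine Con.conGen_le.2 fun u v h => ?_
  change List.Perm _ _
  rcases h with ⟨a, b, c, hab, hbc, rfl, rfl⟩ | ⟨a, b, c, hab, hbc, rfl, rfl⟩ |
    ⟨a, b, c, d, hab, hbc, hcd, rfl, rfl⟩ | ⟨a, b, c, d, hab, hbc, hcd, rfl, rfl⟩ <;>
  · simp only [toList_mul, toList_of]
    rw [List.perm_iff_count]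
    intro x
    simp only [List.count_append]
    omega

section Identity

variable {X : Type*} {u v : FreeMonoid X}

theorem MSatisfies.hypoCon_lift (h : MSatisfies Hypo u v) (f : X → FreeMonoid Alph) :
    hypoCon (FreeMonoid.lift f u) (FreeMonoid.lift f v) :=
  (Con.eq _).1 (h (hypoCon.mk'.comp (FreeMonoid.lift f)))

variable [DecidableEq X]

theorem count_toList_lift_ite (x : X) (u : FreeMonoid X) :
    (FreeMonoid.lift (fun z => if z = x then of (1 : Alph) else 1) u).toList.count 1
      = u.toList.count x := by
  induction u using FreeMonoid.inductionOn' with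
  | one => simp
  | of_mul z u ih =>
    simp only [map_mul, lift_eval_of, toList_mul, List.count_append, ih, toList_of]
    by_cases h : z = x <;> simp [h]

theorem MSatisfies.perm (h : MSatisfies Hypo u v) : u.toList.Perm v.toList := by
  rw [List.perm_iff_count]
  intro x
  have := hypoCon_le_contentCon
    (h.hypoCon_lift fun z => if z = x then of (1 : Alph) else 1)
  simpa only [count_toList_lift_ite] using List.Perm.count_eq this 1

theorem lift_two_letters {x y : X} (hxy : x ≠ y) (u : FreeMonoid X) :
    let w := (FreeMonoid.lift
      (fun z => if z = x then of (2 : Alph) else if z = y then of 1 else 1) u).toList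
    (2 ∈ w ↔ x ∈ u.toList) ∧ (1 ∈ w ↔ y ∈ u.toList) ∧
      ([2, 1].Sublist w ↔ [x, y].Sublist u.toList) := by
  induction u using FreeMonoid.inductionOn' with
  | one => simp
  | of_mul z u ih =>
    simp only [map_mul, lift_eval_of, toList_mul, toList_of, List.mem_append,
      pair_sublist_append] at ih ⊢
    obtain ⟨i1, i2, i3⟩ := ih
    rw [i1, i2, i3]
    by_cases hx : z = x
    · subst hx
      simp [hxy.symm]
    · by_cases hy : z = y
      · subst hy
        simp [hx, hxy]
      · simp [hx, hy, Ne.symm hx, Ne.symm hy]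

theorem MSatisfies.pair_sublist_iff (h : MSatisfies Hypo u v) {x y : X} (hxy : x ≠ y) :
    [x, y].Sublist u.toList ↔ [x, y].Sublist v.toList := by
  rw [← (lift_two_letters hxy u).2.2, ← (lift_two_letters hxy v).2.2]
  exact (hypoCon_le_inversionCon (h.hypoCon_lift _)).2

end Identity

theorem mem_or_mem_of_pair_sublist {α : Type*} {x y : α} {w t : List α} (hxy : x ≠ y)
    (h : [x, y].Sublist (w ++ y :: t)) : x ∈ w ∨ y ∈ t := by
  rw [pair_sublist_append, pair_sublist_cons] at h
  rcases h with h | (h | ⟨h, -⟩) | ⟨h, -⟩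
  · exact Or.inl (h.subset (by simp))
  · exact Or.inr (h.subset (by simp))
  · exact absurd h hxy
  · exact Or.inl h

theorem exists_first_difference {α : Type*} {l l' : List α} (h : l ≠ l')
    (hlen : l.length = l'.length) :
    ∃ w x y s t, x ≠ y ∧ l = w ++ x :: s ∧ l' = w ++ y :: t := by
  induction l generalizing l' with
  | nil => cases l' <;> simp_all
  | cons a l ih =>
    rcases l' with _ | ⟨b, l'⟩
    · simp at hlen
    by_cases hab : a = b
    · subst hab
      obtain ⟨w, x, y, s, t, hxy, rfl, rfl⟩ := ih (l' := l') (by simpa using h) (by simpa using hlen)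
      exact ⟨a :: w, x, y, s, t, hxy, rfl, rfl⟩
    · exact ⟨[], a, b, l, l', hab, rfl, rfl⟩

theorem card_toFinset_add_two_le {α : Type*} [DecidableEq α] {l : List α} {x y : α}
    (h : x ≠ y ∧ 2 ≤ l.count x ∧ 2 ≤ l.count y ∨ x = y ∧ 3 ≤ l.count x) :
    l.toFinset.card + 2 ≤ l.length := by
  have hx : x ∈ l := List.count_pos_iff.1 (by omega)
  have hy : y ∈ l.erase x := by
    refine List.count_pos_iff.1 ?_
    rcases h with ⟨hne, h⟩ | ⟨rfl, h⟩
    · rw [List.count_erase_of_ne hne.symm]; omega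
    · rw [List.count_erase_self]; omega
  have hsub : l.toFinset ⊆ ((l.erase x).erase y).toFinset := by
    intro z hz
    rw [List.mem_toFinset, ← List.count_pos_iff] at *
    simp only [List.count_erase, beq_iff_eq]
    grind
  have h1 := Finset.card_le_card hsub
  have h2 := List.toFinset_card_le ((l.erase x).erase y)
  have h3 := List.length_erase_of_mem hx
  have h4 := List.length_erase_of_mem hy
  have h5 := List.length_pos_of_mem hx
  have h6 := List.length_pos_of_mem hy
  omega

/-- Two distinct words with the same content and the same subwords of length two on distinct
letters have length at least two more than their number of letters. -/
theorem card_toFinset_add_two_le_of_perm {α : Type*} [DecidableEq α] {l l' : List α} (hne : l ≠ l')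
    (hp : l.Perm l') (hs : ∀ x y : α, x ≠ y → ([x, y].Sublist l ↔ [x, y].Sublist l')) :
    l.toFinset.card + 2 ≤ l.length := by
  obtain ⟨w, x, y, s, t, hxy, hl, hl'⟩ := exists_first_difference hne hp.length_eq
  have cx := hp.count_eq x
  have cy := hp.count_eq y
  have sxy := hs x y hxy
  have syx := hs y x hxy.symm
  have key : (2 ≤ l.count x ∧ 2 ≤ l.count y) ∨ 3 ≤ l.count x ∨ 3 ≤ l.count y := by
    simp only [hl, hl', List.count_append, List.count_cons_self, List.count_cons_of_ne hxy,
      List.count_cons_of_ne hxy.symm] at cx cy ⊢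
    have hys : y ∈ s := List.count_pos_iff.1 (by omega)
    have hxt : x ∈ t := List.count_pos_iff.1 (by omega)
    have e1 := sxy.1 (by simp [hl, hys])
    have e2 := syx.2 (by simp [hl', hxt])
    have e3 := mem_or_mem_of_pair_sublist hxy (hl' ▸ e1)
    have e4 := mem_or_mem_of_pair_sublist hxy.symm (hl ▸ e2)
    simp only [← List.count_pos_iff] at e3 e4
    omega
  rcases key with h | h | h
  · exact card_toFinset_add_two_le (Or.inl ⟨hxy, h⟩)
  · exact card_toFinset_add_two_le (Or.inr ⟨rfl, h⟩)
  · exact card_toFinset_add_two_le (Or.inr ⟨rfl, h⟩)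

/-- For every `n ≥ 2`: (a) for distinct variables `x, a_1, ..., a_{n-1}`, the monoid
`hypo` satisfies the nontrivial identity `x a_1 ⋯ a_{n-1} x x ≈ x x a_1 ⋯ a_{n-1} x`,
which has length `n + 2` (and involves exactly the `n` variables `x, a_1, ..., a_{n-1}`);
and (b) every nontrivial identity satisfied by `hypo` in which exactly `n` distinct
variables occur has length at least `n + 2`. Hence the shortest nontrivial identity
with `n` variables satisfied by `hypo` has length `n + 2`. -/
theorem hypo_shortest_identity_n_variables (n : ℕ) (hn : 2 ≤ n) :
    (∀ (X : Type*) (x : X) (a : Fin (n - 1) → X),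
      Function.Injective a → (∀ i, a i ≠ x) →
        (MSatisfies Hypo
            (of x * FreeMonoid.ofList (List.ofFn a) * of x * of x)
            (of x * of x * FreeMonoid.ofList (List.ofFn a) * of x) ∧
          of x * FreeMonoid.ofList (List.ofFn a) * of x * of x ≠
            of x * of x * FreeMonoid.ofList (List.ofFn a) * of x ∧
          (of x * FreeMonoid.ofList (List.ofFn a) * of x * of x).toList.length
            = n + 2)) ∧
    (∀ (X : Type*) [DecidableEq X] (u v : FreeMonoid X), u ≠ v →
      MSatisfies Hypo u v → (u.toList ++ v.toList).toFinset.card = n →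
        n + 2 ≤ u.toList.length ∧ u.toList.length = v.toList.length) := by
  refine ⟨fun X x a ha hx => ⟨fun ψ => ?_, fun h => ?_, ?_⟩, fun X _ u v hne h hcard => ?_⟩
  · simpa only [map_mul] using hypo_mul_mul_self (ψ (of x)) (ψ (ofList (List.ofFn a)))
  · obtain ⟨k, rfl⟩ : ∃ k, n = k + 2 := ⟨n - 2, by omega⟩
    have h' := congrArg (fun w => w.toList[1]?) h
    simp [List.ofFn_succ] at h'
    exact hx _ h'
  · simp
    omega
  · have hp := h.perm
    refine ⟨?_, hp.length_eq⟩
    have hu : (u.toList ++ v.toList).toFinset = u.toList.toFinset := by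
      rw [List.toFinset_append, List.toFinset_eq_of_perm _ _ hp, Finset.union_self]
    rw [← hcard, hu]
    exact card_toFinset_add_two_le_of_perm (fun e => hne (toList.injective e)) hp
      fun x y hxy => h.pair_sublist_iff hxy
end
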